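/- Let p be an odd prime, let ℓ,q ≥ 0 be integers, and let 𝓑 = (L,Q) be a quadratic factor on G = 𝔽_p^n of complexity (ℓ,q). Then for every d = (d_a,d_b,d_c,d_{ab},d_{ac},d_{bc}) ∈ (𝔽_p^ℓ × 𝔽_p^q)³ × (𝔽_p^q)³, one has K_{2,2,2}(d) ⊆ Ψ^{-1}(Ω_{B(Σ(d))}), i.e. for every (x_1,x_2,y_1,y_2,z_1,z_2) ∈ K_{2,2,2}(d), Ψ(x_1,x_2,y_1,y_2,z_1,z_2) ∈ Ω_{B(Σ(d))}. -/

import Mathlib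

open scoped BigOperators symmDiff
open Finset

attribute [local instance] Classical.propDecidable

namespace PaperTS

noncomputable section

/-- The group `𝔽_p^n`, written additively. -/
abbrev Vec (p n : ℕ) := Fin n → ZMod p

/-- Dot product on `𝔽_p^n`. -/
def dot {p n : ℕ} (x y : Vec p n) : ZMod p := ∑ i, x i * y i

/-- A quadratic factor of complexity `(ℓ, q)` on `𝔽_p^n`: a set of `ℓ` linearly independent
vectors together with a set of `q` pairwise distinct symmetric matrices. -/
structure QuadFactor (p n ℓ q : ℕ) where
  L : Fin ℓ → Vec p n
  Q : Fin q → Matrix (Fin n) (Fin n) (ZMod p)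
  linIndep : LinearIndependent (ZMod p) L
  symm : ∀ j, (Q j).IsSymm
  inj : Function.Injective Q

/-- Labels of atoms of a quadratic factor of complexity `(ℓ, q)`. -/
abbrev Label (p ℓ q : ℕ) := (Fin ℓ → ZMod p) × (Fin q → ZMod p)

namespace QuadFactor

variable {p n ℓ q : ℕ}

/-- The linear form `β_L`. -/
def betaL (B : QuadFactor p n ℓ q) (x : Vec p n) : Fin ℓ → ZMod p :=
  fun i => dot x (B.L i)

/-- The bilinear form `β_Q`. -/
def betaQ (B : QuadFactor p n ℓ q) (x y : Vec p n) : Fin q → ZMod p :=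
  fun j => dot x ((B.Q j).mulVec y)

/-- The labelling map `β_𝓑`. -/
def betaB (B : QuadFactor p n ℓ q) (x : Vec p n) : Label p ℓ q :=
  (B.betaL x, B.betaQ x x)

/-- The atom of `B` with label `ab`. -/
def atom (B : QuadFactor p n ℓ q) (ab : Label p ℓ q) : Set (Vec p n) :=
  {x | B.betaB x = ab}

/-- The fibre `β_Q^{-1}(d) ⊆ G × G`. -/
def fibQ (B : QuadFactor p n ℓ q) (d : Fin q → ZMod p) : Set (Vec p n × Vec p n) :=
  {xy | B.betaQ xy.1 xy.2 = d}

/-- The rank of a quadratic factor: `n` if `q = 0`, and otherwise the minimal rank of a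
nontrivial linear combination of the matrices. -/
def rank (B : QuadFactor p n ℓ q) : ℕ :=
  if q = 0 then n
  else sInf ((fun c : Fin q → ZMod p => (∑ j, c j • B.Q j).rank) '' {c | c ≠ 0})

end QuadFactor

/-- Refinement of quadratic factors: every atom of `B'` is contained in an atom of `B`. -/
def Refines {p n ℓ' q' ℓ q : ℕ} (B' : QuadFactor p n ℓ' q') (B : QuadFactor p n ℓ q) : Prop :=
  ∀ ab' : Label p ℓ' q', ∃ ab : Label p ℓ q, B'.atom ab' ⊆ B.atom ab

/-- `Σ(d)` for a tuple of labels `d = (d_a, d_b, d_c, d_ab, d_ac, d_bc)`. -/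
def SigmaD {p ℓ q : ℕ} (da db dc : Label p ℓ q) (dab dac dbc : Fin q → ZMod p) :
    Label p ℓ q :=
  (da.1 + db.1 + dc.1, da.2 + db.2 + dc.2 + 2 • dab + 2 • dac + 2 • dbc)

/-- Real-valued indicator function of a set. -/
def ind1 {G : Type*} (S : Set G) : G → ℝ := S.indicator 1

/-- Density of `A` on `P`. -/
def density {G : Type*} (A P : Set G) : ℝ := ((A ∩ P).ncard : ℝ) / (P.ncard : ℝ)

/-- Sum of `g` over a set in a fintype. -/
def setSum {α : Type*} [Fintype α] (s : Set α) (g : α → ℝ) : ℝ :=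
  ∑ x ∈ Finset.univ.filter (fun x => x ∈ s), g x

/-- Average of `g` over a set in a fintype. -/
def expOver {α : Type*} [Fintype α] (s : Set α) (g : α → ℝ) : ℝ :=
  setSum s g / (s.ncard : ℝ)

/-- The normalized indicator `μ_Γ` of `Γ ⊆ G × G`. -/
def mu {G : Type*} [Fintype G] (Γ : Set (G × G)) (xy : G × G) : ℝ :=
  ((Fintype.card G : ℝ) ^ 2 / (Γ.ncard : ℝ)) * ind1 Γ xy

/-- The product of the 8 values of `f` on the cube generated by `x, h₁, h₂, h₃`. -/
def cubeProd {G : Type*} [AddCommGroup G] (f : G → ℝ) (x h₁ h₂ h₃ : G) : ℝ :=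
  f x * f (x + h₁) * f (x + h₂) * f (x + h₃) * f (x + h₁ + h₂) * f (x + h₁ + h₃) *
    f (x + h₂ + h₃) * f (x + h₁ + h₂ + h₃)

/-- The eighth power of the (unnormalized) `U³` norm. -/
def U3pow8 {G : Type*} [AddCommGroup G] [Fintype G] (f : G → ℝ) : ℝ :=
  ∑ x : G, ∑ h₁ : G, ∑ h₂ : G, ∑ h₃ : G, cubeProd f x h₁ h₂ h₃

/-- The (unnormalized) `U³` norm. -/
def U3norm {G : Type*} [AddCommGroup G] [Fintype G] (f : G → ℝ) : ℝ :=
  U3pow8 f ^ ((1 : ℝ) / 8)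

/-- The Prendiville local `U³` norm of `f` relative to the set `B`
(equal to `0` when `‖1_B‖_{U³} = 0`, by the division-by-zero convention). -/
def U3localP {G : Type*} [AddCommGroup G] [Fintype G] (f : G → ℝ) (B : Set G) : ℝ :=
  U3norm (fun x => f x * ind1 B x) / U3norm (ind1 B)

/-- `Ω_B`: the 4-tuples all of whose associated cube points lie in `B`. -/
def Omega {G : Type*} [AddCommGroup G] (B : Set G) : Set (G × G × G × G) :=
  fun t =>
    match t with
    | (x, h₁, h₂, h₃) =>
        x ∈ B ∧ x + h₁ ∈ B ∧ x + h₂ ∈ B ∧ x + h₃ ∈ B ∧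
        x + h₁ + h₂ ∈ B ∧ x + h₁ + h₃ ∈ B ∧ x + h₂ + h₃ ∈ B ∧ x + h₁ + h₂ + h₃ ∈ B

/-- The change of variables `Ψ : G⁶ → G⁴`. -/
def Psi {G : Type*} [AddCommGroup G] : G × G × G × G × G × G → G × G × G × G :=
  fun t =>
    match t with
    | (x₁, x₂, y₁, y₂, z₁, z₂) => (x₁ + y₁ + z₁, x₂ - x₁, y₂ - y₁, z₂ - z₁)

/-- `K_{2,2,2}(d)`. -/
def K222 {p n ℓ q : ℕ} (B : QuadFactor p n ℓ q) (da db dc : Label p ℓ q)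
    (dab dac dbc : Fin q → ZMod p) :
    Set (Vec p n × Vec p n × Vec p n × Vec p n × Vec p n × Vec p n) :=
  fun t =>
    match t with
    | (x₁, x₂, y₁, y₂, z₁, z₂) =>
        B.betaB x₁ = da ∧ B.betaB x₂ = da ∧ B.betaB y₁ = db ∧ B.betaB y₂ = db ∧
        B.betaB z₁ = dc ∧ B.betaB z₂ = dc ∧
        B.betaQ x₁ y₁ = dab ∧ B.betaQ x₁ y₂ = dab ∧ B.betaQ x₂ y₁ = dab ∧ B.betaQ x₂ y₂ = dab ∧
        B.betaQ x₁ z₁ = dac ∧ B.betaQ x₁ z₂ = dac ∧ B.betaQ x₂ z₁ = dac ∧ B.betaQ x₂ z₂ = dac ∧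
        B.betaQ y₁ z₁ = dbc ∧ B.betaQ y₁ z₂ = dbc ∧ B.betaQ y₂ z₁ = dbc ∧ B.betaQ y₂ z₂ = dbc

/-- The product `∏_{i,j,k ∈ {1,2}} f (x_i + y_j + z_k)` for a 6-tuple. -/
def prod8 {G : Type*} [AddCommGroup G] (f : G → ℝ) :
    G × G × G × G × G × G → ℝ :=
  fun t =>
    match t with
    | (x₁, x₂, y₁, y₂, z₁, z₂) =>
        f (x₁ + y₁ + z₁) * f (x₁ + y₁ + z₂) * f (x₁ + y₂ + z₁) * f (x₁ + y₂ + z₂) *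
        f (x₂ + y₁ + z₁) * f (x₂ + y₁ + z₂) * f (x₂ + y₂ + z₁) * f (x₂ + y₂ + z₂)

/-- The eighth power of the Terry–Wolf local `U³` norm. -/
def TW8 {p n ℓ q : ℕ} [NeZero p] (B : QuadFactor p n ℓ q) (f : Vec p n → ℝ)
    (da db dc : Label p ℓ q) (dab dac dbc : Fin q → ZMod p) : ℝ :=
  expOver (B.atom da) fun x₀ => expOver (B.atom da) fun x₁ =>
  expOver (B.atom db) fun y₀ => expOver (B.atom db) fun y₁ =>
  expOver (B.atom dc) fun z₀ => expOver (B.atom dc) fun z₁ =>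
    (mu (B.fibQ dab) (x₀, y₀) * mu (B.fibQ dab) (x₀, y₁) *
     mu (B.fibQ dab) (x₁, y₀) * mu (B.fibQ dab) (x₁, y₁) *
     mu (B.fibQ dac) (x₀, z₀) * mu (B.fibQ dac) (x₀, z₁) *
     mu (B.fibQ dac) (x₁, z₀) * mu (B.fibQ dac) (x₁, z₁) *
     mu (B.fibQ dbc) (y₀, z₀) * mu (B.fibQ dbc) (y₀, z₁) *
     mu (B.fibQ dbc) (y₁, z₀) * mu (B.fibQ dbc) (y₁, z₁)) *
    prod8 f (x₀, x₁, y₀, y₁, z₀, z₁)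

/-- `A` has VC₂-dimension at least `k`. -/
def HasVC2Dim {G : Type*} [AddCommGroup G] (A : Set G) (k : ℕ) : Prop :=
  ∃ (a b : Fin k → G) (c : Set (Fin k × Fin k) → G),
    ∀ (i j : Fin k) (S : Set (Fin k × Fin k)), (a i + b j + c S ∈ A ↔ (i, j) ∈ S)

/-- `A` has VC₂-dimension at most `k`. -/
def VC2dimLE {G : Type*} [AddCommGroup G] (A : Set G) (k : ℕ) : Prop :=
  ∀ m : ℕ, HasVC2Dim A m → m ≤ k

/-- A growth function: an increasing function `ℝ → ℝ≥0`. -/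
def GrowthFunction (ρ : ℝ → ℝ) : Prop :=
  Monotone ρ ∧ ∀ x, 0 ≤ ρ x

/-- `ρ` is bounded by a polynomial of degree `d` on `[1, ∞)`. -/
def PolyBound (ρ : ℝ → ℝ) (d : ℕ) : Prop :=
  ∃ C > (0 : ℝ), ∀ x : ℝ, 1 ≤ x → ρ x ≤ C * x ^ d

/-- `ρ` is a polynomial growth function of degree (exactly) `d`, i.e. `d ≥ 1` is minimal
with `ρ(x) ≤ C x^d` for `x ≥ 1`. -/
def PolyGrowthDegree (ρ : ℝ → ℝ) (d : ℕ) : Prop :=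
  1 ≤ d ∧ PolyBound ρ d ∧ ∀ d' : ℕ, 1 ≤ d' → PolyBound ρ d' → d ≤ d'

/-- The index `ind(A, 𝒫)` of a partition. -/
def indx {p n : ℕ} (A : Set (Vec p n)) (Ps : Finset (Set (Vec p n))) : ℝ :=
  (∑ P ∈ Ps, density A P ^ 2 * (P.ncard : ℝ)) / (p : ℝ) ^ n

/-- `P` fails to be `δ`-uniform for `A` with respect to the localized `U³` norm. -/
def BadPart {G : Type*} [AddCommGroup G] [Fintype G] (δ : ℝ) (A P : Set G) : Prop :=
  δ * U3norm (ind1 P) < U3norm (fun x => (ind1 A x - density A P) * ind1 P x)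

/-- `ker(U)^⊥`, the orthogonal complement of the kernel of `U`. -/
def kerPerp {p n : ℕ} (U : Matrix (Fin n) (Fin n) (ZMod p)) : Set (Vec p n) :=
  {v | ∀ w : Vec p n, U.mulVec w = 0 → dot v w = 0}

/-- `B'` is a `ρ`-matrix deletion of `B`. -/
def IsMatrixDeletion {p n ℓ' q' ℓ q : ℕ} (ρ : ℝ → ℝ)
    (B' : QuadFactor p n ℓ' q') (B : QuadFactor p n ℓ q) : Prop :=
  q' + 1 = q ∧
  ∃ c : Fin q → ZMod p, c ≠ 0 ∧
    (((∑ j, c j • B.Q j).rank : ℝ) < ρ ((ℓ : ℝ) + (q : ℝ))) ∧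
    (∃ i : Fin q, c i ≠ 0 ∧ Set.range B'.Q = Set.range B.Q \ {B.Q i}) ∧
    Set.range B.L ⊆ Set.range B'.L ∧
    Submodule.span (ZMod p) (Set.range B'.L) =
      Submodule.span (ZMod p) (Set.range B.L ∪ kerPerp (∑ j, c j • B.Q j))

/-- The functions `τ_i^ρ : ℤ × ℤ → ℝ`. -/
def tau (ρ : ℝ → ℝ) : ℕ → ℤ × ℤ → ℝ
  | 0, xy => (xy.1 : ℝ)
  | i + 1, xy => tau ρ i xy + ρ (tau ρ i xy + (xy.2 : ℝ) - (i : ℝ))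

/-- `f_σ^ρ` for binary strings `σ : Fin m → ℤ` (with values in `{-1, 1}`). -/
def fseq (ρ : ℝ → ℝ) : (m : ℕ) → (Fin m → ℤ) → ℝ × ℝ
  | 0, _ => (0, 0)
  | m + 1, σ =>
      let ab := fseq ρ m (fun j => σ j.castSucc)
      if σ (Fin.last m) = 1 then (ab.1 + 1, ab.2 + 1)
      else (ab.1 + ρ (ab.1 + ab.2), ab.2 - 1)

end

namespace QuadFactor

variable {p n ℓ q : ℕ}

lemma betaL_add (B : QuadFactor p n ℓ q) (x y : Vec p n) :
    B.betaL (x + y) = B.betaL x + B.betaL y :=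
  funext fun i => add_dotProduct x y (B.L i)

lemma betaQ_add_left (B : QuadFactor p n ℓ q) (x y z : Vec p n) :
    B.betaQ (x + y) z = B.betaQ x z + B.betaQ y z :=
  funext fun j => add_dotProduct x y ((B.Q j).mulVec z)

lemma betaQ_comm (B : QuadFactor p n ℓ q) (x y : Vec p n) :
    B.betaQ x y = B.betaQ y x := by
  funext j
  change x ⬝ᵥ (B.Q j).mulVec y = y ⬝ᵥ (B.Q j).mulVec x
  rw [Matrix.dotProduct_mulVec, ← Matrix.mulVec_transpose, (B.symm j).eq, dotProduct_comm]

lemma betaQ_add_right (B : QuadFactor p n ℓ q) (x y z : Vec p n) :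
    B.betaQ x (y + z) = B.betaQ x y + B.betaQ x z := by
  rw [betaQ_comm, betaQ_add_left, betaQ_comm B y, betaQ_comm B z]

lemma add_add_mem_atom_SigmaD (B : QuadFactor p n ℓ q) {x y z : Vec p n}
    {da db dc : Label p ℓ q} {dab dac dbc : Fin q → ZMod p}
    (hx : B.betaB x = da) (hy : B.betaB y = db) (hz : B.betaB z = dc)
    (hxy : B.betaQ x y = dab) (hxz : B.betaQ x z = dac) (hyz : B.betaQ y z = dbc) :
    x + y + z ∈ B.atom (SigmaD da db dc dab dac dbc) := by
  subst hx hy hz hxy hxz hyz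
  refine Prod.ext ?_ ?_
  · simp only [betaB, SigmaD, betaL_add]
  · simp only [betaB, SigmaD, betaQ_add_left, betaQ_add_right, betaQ_comm B y x,
      betaQ_comm B z x, betaQ_comm B z y]
    abel

end QuadFactor

theorem statement13 (p n ℓ q : ℕ) (hp : p.Prime) (hodd : Odd p)
    (B : QuadFactor p n ℓ q) (da db dc : Label p ℓ q) (dab dac dbc : Fin q → ZMod p) :
    K222 B da db dc dab dac dbc ⊆
      Psi ⁻¹' Omega (B.atom (SigmaD da db dc dab dac dbc)) := by
  rintro ⟨x₁, x₂, y₁, y₂, z₁, z₂⟩ ⟨hx₁, hx₂, hy₁, hy₂, hz₁, hz₂, h₁₁, h₁₂, h₂₁, h₂₂,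
    k₁₁, k₁₂, k₂₁, k₂₂, m₁₁, m₁₂, m₂₁, m₂₂⟩
  refine ⟨B.add_add_mem_atom_SigmaD hx₁ hy₁ hz₁ h₁₁ k₁₁ m₁₁, ?_, ?_, ?_, ?_, ?_, ?_, ?_⟩
  · convert B.add_add_mem_atom_SigmaD hx₂ hy₁ hz₁ h₂₁ k₂₁ m₁₁ using 1
    abel
  · convert B.add_add_mem_atom_SigmaD hx₁ hy₂ hz₁ h₁₂ k₁₁ m₂₁ using 1
    abel
  · convert B.add_add_mem_atom_SigmaD hx₁ hy₁ hz₂ h₁₁ k₁₂ m₁₂ using 1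
    abel
  · convert B.add_add_mem_atom_SigmaD hx₂ hy₂ hz₁ h₂₂ k₂₁ m₂₁ using 1
    abel
  · convert B.add_add_mem_atom_SigmaD hx₂ hy₁ hz₂ h₂₁ k₂₂ m₁₂ using 1
    abel
  · convert B.add_add_mem_atom_SigmaD hx₁ hy₂ hz₂ h₁₂ k₁₂ m₂₂ using 1
    abel
  · convert B.add_add_mem_atom_SigmaD hx₂ hy₂ hz₂ h₂₂ k₂₂ m₂₂ using 1
    abel

end PaperTS
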